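/- arXiv:2601.22521 — 2 statements merged into one kernel-verified Lean document; each statement's English description precedes it below -/
import Mathlib

section
/- Let n be a positive integer and let z_1, ..., z_n be real numbers, not all equal. For p ≥ 0 define w_t(p) = exp(p z_t) / ∑_{j=1}^n exp(p z_j) and ESS_norm(p) = (1/n) / ∑_{t=1}^n w_t(p)^2. Then ESS_norm(0) = 1, ESS_norm is continuous and strictly decreasing on [0, ∞), and consequently for every target η* with ESS_norm(P) ≤ η* ≤ 1 for some P ≥ 0, there exists a unique p ∈ [0, P] such that ESS_norm(p) = η*. -/
open Finset

/-- The softmax weights with inverse temperature `p`. -/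
noncomputable def softmaxW (n : ℕ) (z : Fin n → ℝ) (p : ℝ) (t : Fin n) : ℝ :=
  Real.exp (p * z t) / ∑ j, Real.exp (p * z j)

/-- The normalized effective sample size of the softmax weights. -/
noncomputable def essNorm (n : ℕ) (z : Fin n → ℝ) (p : ℝ) : ℝ :=
  (1 / (n : ℝ)) / ∑ t, softmaxW n z p t ^ 2

/-- The weighted covariance identity behind the Chebyshev sum and Cauchy-Schwarz inequalities. -/
lemma sum_mul_sum_sub_sum_mul_sum {ι : Type*} [Fintype ι] (w f g : ι → ℝ) :
    2 * ((∑ i, w i) * ∑ i, w i * f i * g i - (∑ i, w i * f i) * ∑ i, w i * g i) =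
      ∑ i, ∑ j, w i * w j * ((f i - f j) * (g i - g j)) := by
  have h₁ : ∑ i, ∑ j, w i * w j * ((f i - f j) * (g i - g j)) =
      ∑ i, ∑ j, ((w i * f i * g i) * w j - (w i * f i) * (w j * g j)
        - (w i * g i) * (w j * f j) + w i * (w j * f j * g j)) :=
    sum_congr rfl fun i _ => sum_congr rfl fun j _ => by ring
  rw [h₁]
  simp only [sum_add_distrib, sum_sub_distrib, ← sum_mul_sum]
  ring

lemma sum_mul_sum_le_of_monovary {ι : Type*} [Fintype ι] {w f g : ι → ℝ}
    (hw : ∀ i, 0 ≤ w i) (hfg : ∀ i j, 0 ≤ (f i - f j) * (g i - g j)) :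
    (∑ i, w i * f i) * ∑ i, w i * g i ≤ (∑ i, w i) * ∑ i, w i * f i * g i := by
  have h := sum_mul_sum_sub_sum_mul_sum w f g
  have h₀ : 0 ≤ ∑ i, ∑ j, w i * w j * ((f i - f j) * (g i - g j)) :=
    sum_nonneg fun i _ => sum_nonneg fun j _ => mul_nonneg (mul_nonneg (hw i) (hw j)) (hfg i j)
  linarith

lemma sq_sum_mul_lt_of_ne {ι : Type*} [Fintype ι] {w f : ι → ℝ}
    (hw : ∀ i, 0 < w i) {s t : ι} (hst : f s ≠ f t) :
    (∑ i, w i * f i) ^ 2 < (∑ i, w i) * ∑ i, w i * f i * f i := by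
  have h := sum_mul_sum_sub_sum_mul_sum w f f
  have hnn : ∀ i j, 0 ≤ w i * w j * ((f i - f j) * (f i - f j)) := fun i j =>
    mul_nonneg (mul_pos (hw i) (hw j)).le (mul_self_nonneg _)
  have h₀ : 0 < ∑ i, ∑ j, w i * w j * ((f i - f j) * (f i - f j)) :=
    sum_pos' (fun i _ => sum_nonneg fun j _ => hnn i j) ⟨s, mem_univ s,
      sum_pos' (fun j _ => hnn s j) ⟨t, mem_univ t,
        mul_pos (mul_pos (hw s) (hw t)) (mul_self_pos.2 (sub_ne_zero.2 hst))⟩⟩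
  linarith

lemma sum_exp_pos {n : ℕ} (hn : 0 < n) (z : Fin n → ℝ) (p : ℝ) :
    0 < ∑ t, Real.exp (p * z t) :=
  sum_pos (fun _ _ => Real.exp_pos _) ⟨⟨0, hn⟩, mem_univ _⟩

lemma sum_exp_sq_pos {n : ℕ} (hn : 0 < n) (z : Fin n → ℝ) (p : ℝ) :
    0 < ∑ t, Real.exp (p * z t) ^ 2 :=
  sum_pos (fun _ _ => pow_pos (Real.exp_pos _) 2) ⟨⟨0, hn⟩, mem_univ _⟩

lemma essNorm_eq (n : ℕ) (z : Fin n → ℝ) (p : ℝ) :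
    essNorm n z p =
      (1 / (n : ℝ)) * ((∑ t, Real.exp (p * z t)) ^ 2 / ∑ t, Real.exp (p * z t) ^ 2) := by
  simp only [essNorm, softmaxW, div_pow, ← sum_div]
  rw [div_div_eq_mul_div, mul_div_assoc]

lemma essNorm_zero {n : ℕ} (hn : 0 < n) (z : Fin n → ℝ) : essNorm n z 0 = 1 := by
  have : (n : ℝ) ≠ 0 := by positivity
  simp only [essNorm_eq, zero_mul, Real.exp_zero, one_pow, sum_const, card_univ, Fintype.card_fin,
    nsmul_eq_mul, mul_one]
  field_simp

lemma continuous_essNorm {n : ℕ} (hn : 0 < n) (z : Fin n → ℝ) : Continuous (essNorm n z) := by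
  rw [funext (essNorm_eq n z)]
  exact continuous_const.mul
    (Continuous.div (by fun_prop) (by fun_prop) fun p => (sum_exp_sq_pos hn z p).ne')

lemma exp_sub_mul_exp_sub_nonneg {p d : ℝ} (hp : 0 ≤ p) (hd : 0 ≤ d) (x y : ℝ) :
    0 ≤ (Real.exp (p * x) - Real.exp (p * y)) * (Real.exp (d * x) - Real.exp (d * y)) := by
  rcases le_total x y with h | h
  · exact mul_nonneg_of_nonpos_of_nonpos (sub_nonpos.2 (by gcongr)) (sub_nonpos.2 (by gcongr))
  · exact mul_nonneg (sub_nonneg.2 (by gcongr)) (sub_nonneg.2 (by gcongr))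

lemma strictAntiOn_essNorm {n : ℕ} (hn : 0 < n) {z : Fin n → ℝ} {s t : Fin n} (hst : z s ≠ z t) :
    StrictAntiOn (essNorm n z) (Set.Ici 0) := by
  intro p hp q _ hpq
  have hd : 0 < q - p := sub_pos.2 hpq
  have hexp : ∀ i, Real.exp (q * z i) = Real.exp (p * z i) * Real.exp ((q - p) * z i) := fun i => by
    rw [← Real.exp_add]; ring_nf
  have hne : Real.exp ((q - p) * z s) ≠ Real.exp ((q - p) * z t) := fun h =>
    hst (mul_left_cancel₀ hd.ne' (Real.exp_injective h))
  have hcheb := sum_mul_sum_le_of_monovary (w := fun i => Real.exp (p * z i))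
    (fun i => (Real.exp_pos _).le)
    fun i j => exp_sub_mul_exp_sub_nonneg (Set.mem_Ici.1 hp) hd.le (z i) (z j)
  have hcs := sq_sum_mul_lt_of_ne (w := fun i => Real.exp (p * z i) ^ 2)
    (f := fun i => Real.exp ((q - p) * z i)) (fun i => pow_pos (Real.exp_pos _) 2) hne
  have hS := sum_exp_pos hn z p
  have hS₂ := sum_exp_sq_pos hn z p
  have hT := sum_exp_pos hn z q
  have hT₂ := sum_exp_sq_pos hn z q
  have hT₂_eq : ∑ i, Real.exp (p * z i) ^ 2 * Real.exp ((q - p) * z i) * Real.exp ((q - p) * z i) =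
      ∑ i, Real.exp (q * z i) ^ 2 := sum_congr rfl fun i _ => by rw [hexp]; ring
  simp only [← hexp, ← sq] at hcheb
  simp only [hT₂_eq] at hcs
  rw [essNorm_eq, essNorm_eq]
  refine mul_lt_mul_of_pos_left ?_ (by positivity)
  rw [div_lt_div_iff₀ hT₂ hS₂]
  refine lt_of_mul_lt_mul_right ?_ hS₂.le
  calc _ = ((∑ i, Real.exp (p * z i) ^ 2) * ∑ i, Real.exp (q * z i)) ^ 2 := by ring
    _ ≤ ((∑ i, Real.exp (p * z i)) *
          ∑ i, Real.exp (p * z i) ^ 2 * Real.exp ((q - p) * z i)) ^ 2 := by gcongr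
    _ = (∑ i, Real.exp (p * z i)) ^ 2 *
          (∑ i, Real.exp (p * z i) ^ 2 * Real.exp ((q - p) * z i)) ^ 2 := by ring
    _ < (∑ i, Real.exp (p * z i)) ^ 2 *
          ((∑ i, Real.exp (p * z i) ^ 2) * ∑ i, Real.exp (q * z i) ^ 2) := by gcongr
    _ = _ := by ring

/-- If the `zₜ` are not all equal, then `ESS_norm(0) = 1`, `ESS_norm` is continuous and
strictly decreasing on `[0, ∞)`, and for every target `η*` with
`ESS_norm(P) ≤ η* ≤ 1` for some `P ≥ 0`, there exists a unique `p ∈ [0, P]` with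
`ESS_norm(p) = η*`. -/
theorem essNorm_bisection (n : ℕ) (hn : 0 < n) (z : Fin n → ℝ)
    (hz : ¬ ∀ s t, z s = z t) :
    essNorm n z 0 = 1 ∧
    ContinuousOn (essNorm n z) (Set.Ici 0) ∧
    StrictAntiOn (essNorm n z) (Set.Ici 0) ∧
    (∀ P : ℝ, 0 ≤ P → ∀ η : ℝ, essNorm n z P ≤ η → η ≤ 1 →
      ∃! p : ℝ, p ∈ Set.Icc 0 P ∧ essNorm n z p = η) := by
  push Not at hz
  obtain ⟨s, t, hst⟩ := hz
  have hanti := strictAntiOn_essNorm hn hst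
  have hcont := continuous_essNorm hn z
  refine ⟨essNorm_zero hn z, hcont.continuousOn, hanti, fun P hP η hη hη₁ => ?_⟩
  obtain ⟨p, hp, rfl⟩ := intermediate_value_Icc' hP hcont.continuousOn
    ⟨hη, hη₁.trans_eq (essNorm_zero hn z).symm⟩
  exact ⟨p, ⟨hp, rfl⟩, fun q hq => hanti.injOn hq.1.1 hp.1 hq.2⟩
end

section
/- Let n be a positive integer and let z_1, ..., z_n be real numbers, not all equal. For p ∈ ℝ define w_t(p) = exp(p z_t) / ∑_{j=1}^n exp(p z_j), z̄_p = ∑_{k=1}^n w_k(p) z_k, and S(p) = ∑_{t=1}^n w_t(p)^2. Then for every p > 0, S'(p) > 0; equivalently, ∑_{t=1}^n w_t(p)^2 (z_t − z̄_p) > 0. -/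
open Finset

/-- The softmax-weighted mean of the `zₜ`. -/
noncomputable def softmaxMean (n : ℕ) (z : Fin n → ℝ) (p : ℝ) : ℝ :=
  ∑ k, softmaxW n z p k * z k

/-- The sum of squared softmax weights. -/
noncomputable def sqWeightSum (n : ℕ) (z : Fin n → ℝ) (p : ℝ) : ℝ :=
  ∑ t, softmaxW n z p t ^ 2

theorem sum_exp_mul_pos {n : ℕ} (hn : 0 < n) (z : Fin n → ℝ) (p : ℝ) :
    0 < ∑ j, Real.exp (p * z j) :=
  Finset.sum_pos (fun _ _ => Real.exp_pos _) ⟨⟨0, hn⟩, Finset.mem_univ _⟩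

theorem sum_softmaxW {n : ℕ} (hn : 0 < n) (z : Fin n → ℝ) (p : ℝ) :
    ∑ t, softmaxW n z p t = 1 := by
  have hZ := sum_exp_mul_pos hn z p
  simp only [softmaxW, ← Finset.sum_div]
  exact div_self hZ.ne'

theorem softmaxW_pos {n : ℕ} (hn : 0 < n) (z : Fin n → ℝ) (p : ℝ) (t : Fin n) :
    0 < softmaxW n z p t :=
  div_pos (Real.exp_pos _) (sum_exp_mul_pos hn z p)

theorem softmaxW_lt_softmaxW {n : ℕ} (hn : 0 < n) {z : Fin n → ℝ} {p : ℝ} (hp : 0 < p)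
    {s t : Fin n} (h : z s < z t) : softmaxW n z p s < softmaxW n z p t :=
  div_lt_div_of_pos_right (Real.exp_lt_exp.2 (mul_lt_mul_of_pos_left h hp))
    (sum_exp_mul_pos hn z p)

theorem hasDerivAt_softmaxW {n : ℕ} (hn : 0 < n) (z : Fin n → ℝ) (p : ℝ) (t : Fin n) :
    HasDerivAt (fun q => softmaxW n z q t)
      (softmaxW n z p t * (z t - softmaxMean n z p)) p := by
  have hZ := sum_exp_mul_pos hn z p
  have hexp (j : Fin n) :
      HasDerivAt (fun q => Real.exp (q * z j)) (Real.exp (p * z j) * z j) p := by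
    simpa using ((hasDerivAt_id p).mul_const (z j)).exp
  have hmean : softmaxMean n z p =
      (∑ j, Real.exp (p * z j) * z j) / ∑ j, Real.exp (p * z j) := by
    simp only [softmaxMean, softmaxW, Finset.sum_div, div_mul_eq_mul_div]
  have hsum : HasDerivAt (fun q => ∑ j, Real.exp (q * z j))
      (∑ j, Real.exp (p * z j) * z j) p :=
    HasDerivAt.fun_sum fun j _ => hexp j
  refine ((hexp t).div hsum hZ.ne').congr_deriv ?_
  rw [hmean, softmaxW]
  field_simp

theorem hasDerivAt_sqWeightSum {n : ℕ} (hn : 0 < n) (z : Fin n → ℝ) (p : ℝ) :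
    HasDerivAt (sqWeightSum n z)
      (2 * ∑ t, softmaxW n z p t ^ 2 * (z t - softmaxMean n z p)) p := by
  have h : HasDerivAt (fun q => ∑ t, softmaxW n z q t ^ 2) _ p :=
    HasDerivAt.fun_sum fun t _ => (hasDerivAt_softmaxW hn z p t).fun_pow 2
  refine h.congr_deriv ?_
  rw [Finset.mul_sum]
  refine Finset.sum_congr rfl fun t _ => ?_
  push_cast
  ring

/-- Symmetrization of a weighted covariance between the weights and the values. -/
theorem two_mul_sum_sq_mul_sub_mean {ι : Type*} [Fintype ι] {w : ι → ℝ} (hw : ∑ t, w t = 1)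
    (z : ι → ℝ) :
    2 * ∑ t, w t ^ 2 * (z t - ∑ k, w k * z k) =
      ∑ t, ∑ k, w t * w k * ((w t - w k) * (z t - z k)) := by
  have expand (t k : ι) : w t * w k * ((w t - w k) * (z t - z k)) =
      w t ^ 2 * z t * w k - w t ^ 2 * (w k * z k) - w t * z t * w k ^ 2
        + w t * (w k ^ 2 * z k) := by ring
  simp_rw [expand, mul_sub (w _ ^ 2)]
  simp only [Finset.sum_add_distrib, Finset.sum_sub_distrib, ← Finset.mul_sum,
    ← Finset.sum_mul, hw]
  ring

theorem sum_sq_softmaxW_mul_sub_softmaxMean_pos {n : ℕ} (hn : 0 < n) {z : Fin n → ℝ}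
    (hz : ¬ ∀ s t, z s = z t) {p : ℝ} (hp : 0 < p) :
    0 < ∑ t, softmaxW n z p t ^ 2 * (z t - softmaxMean n z p) := by
  have hterm (s t : Fin n) (h : z s ≠ z t) : 0 < softmaxW n z p s * softmaxW n z p t *
      ((softmaxW n z p s - softmaxW n z p t) * (z s - z t)) := by
    refine mul_pos (mul_pos (softmaxW_pos hn z p s) (softmaxW_pos hn z p t)) ?_
    rcases h.lt_or_gt with h | h
    · exact mul_pos_of_neg_of_neg (sub_neg.2 (softmaxW_lt_softmaxW hn hp h)) (sub_neg.2 h)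
    · exact mul_pos (sub_pos.2 (softmaxW_lt_softmaxW hn hp h)) (sub_pos.2 h)
  have hnonneg (s t : Fin n) : 0 ≤ softmaxW n z p s * softmaxW n z p t *
      ((softmaxW n z p s - softmaxW n z p t) * (z s - z t)) := by
    by_cases h : z s = z t
    · simp [h]
    · exact (hterm s t h).le
  push Not at hz
  obtain ⟨s, t, hst⟩ := hz
  have hpos := Finset.sum_pos' (fun s _ => Finset.sum_nonneg fun t _ => hnonneg s t)
    ⟨s, Finset.mem_univ s, Finset.sum_pos' (fun t _ => hnonneg s t)
      ⟨t, Finset.mem_univ t, hterm s t hst⟩⟩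
  rw [← two_mul_sum_sq_mul_sub_mean (sum_softmaxW hn z p) z] at hpos
  exact pos_of_mul_pos_right hpos zero_le_two

/-- If the `zₜ` are not all equal, then for every `p > 0` the derivative of
`S(p) = ∑ₜ wₜ(p)²` is positive; equivalently, `∑ₜ wₜ(p)² (zₜ − z̄_p) > 0`. -/
theorem deriv_sqWeightSum_pos (n : ℕ) (hn : 0 < n) (z : Fin n → ℝ)
    (hz : ¬ ∀ s t, z s = z t) :
    ∀ p : ℝ, 0 < p →
      0 < deriv (sqWeightSum n z) p ∧
      0 < ∑ t, softmaxW n z p t ^ 2 * (z t - softmaxMean n z p) := by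
  intro p hp
  have h := sum_sq_softmaxW_mul_sub_softmaxMean_pos hn hz hp
  rw [(hasDerivAt_sqWeightSum hn z p).deriv]
  exact ⟨mul_pos two_pos h, h⟩
end
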